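/- arXiv:2511.02553 — 4 statements merged into one kernel-verified Lean document; each statement's English description precedes it below -/
import Mathlib

section
/- Let 1 ≤ σ, q, r < ∞ and θ ∈ (0,1) satisfy −n/σ ≤ θ·(1 − n/q) − (1−θ)·n/r. Then there exists a constant c = c(n,σ) > 0 such that for every ball B_ρ(x_o) ⊂ ℝⁿ with ρ > 0 and every continuously differentiable function u : ℝⁿ → ℝ whose restriction and gradient are integrable to the relevant powers on B_ρ(x_o), one has ⨍_{B_ρ(x_o)} |u|^σ/ρ^σ dx ≤ c · ( ⨍_{B_ρ(x_o)} ( |u|^q/ρ^q + |Du|^q ) dx )^{θσ/q} · ( ⨍_{B_ρ(x_o)} |u|^r/ρ^r dx )^{(1−θ)σ/r}. -/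
open Set MeasureTheory Metric
open scoped ENNReal

theorem le_of_convexOn_of_antitoneOn_of_sobolev {L : ℝ → ℝ} (hL : ConvexOn ℝ (Ici 0) L)
    (hanti : AntitoneOn L (Ici 0)) {d K w σ k b θ : ℝ} (hd0 : 0 ≤ d)
    (hσ : 1 ≤ σ) (hk0 : 0 < k) (hk1 : k ≤ 1) (hb : 0 ≤ b) (hθ0 : 0 < θ) (hθ1 : θ < 1)
    (hone : L d ≤ K + w)
    (hpow : ∀ γ, 1 < γ →
      γ * L (d / γ) ≤ K + Real.log γ + (γ - 1) * L ((1 - k) / (γ - 1)) + w)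
    (hc : θ * (k - 1 + d) + (1 - θ) * b ≤ 1 / σ) :
    L (1 / σ) ≤ θ * (K + Real.log (σ + 1) + w) + (1 - θ) * L b := by
  have conv : ∀ x y l, 0 ≤ x → 0 ≤ y → 0 ≤ l → l ≤ 1 →
      L (l * x + (1 - l) * y) ≤ l * L x + (1 - l) * L y := fun x y l hx hy h0 h1 =>
    hL.2 hx hy h0 (sub_nonneg.2 h1) (by ring)
  have anti : ∀ x y, 0 ≤ x → x ≤ y → L y ≤ L x := fun x y hx hxy =>
    hanti hx (hx.trans hxy) hxy
  have hσ0 : 0 < σ := by linarith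
  have hlog : 0 ≤ Real.log (σ + 1) := Real.log_nonneg (by linarith)
  set e := k - 1 + d with he
  set X := K + Real.log (σ + 1) + w with hX
  have hed : e ≤ d := by linarith
  by_cases h1 : d / (σ + 1) ≤ e
  · have he0 : 0 ≤ e := le_trans (by positivity) h1
    have hLe : L e ≤ X := by
      rcases hed.eq_or_lt with h | h
      · rw [h]; linarith
      · have hepos : 0 < e := by
          rcases he0.eq_or_lt with h0 | h0
          · rw [← h0] at h1 h
            have : 0 < d / (σ + 1) := by positivity
            linarith
          · exact h0
        have hγ : 1 < d / e := by rwa [one_lt_div hepos]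
        have := hpow _ hγ
        have e1 : d / (d / e) = e := by
          have : d ≠ 0 := by linarith
          field_simp
        have e2 : (1 - k) / (d / e - 1) = e := by
          have : (1 : ℝ) - k = d - e := by linarith
          rw [this]
          have : d - e ≠ 0 := by linarith
          field_simp
        rw [e1, e2] at this
        have hl : Real.log (d / e) ≤ Real.log (σ + 1) := by
          apply Real.log_le_log (by linarith)
          rw [div_le_iff₀ (by linarith)] at h1
          rw [div_le_iff₀ hepos]; linarith
        linarith
    have h2 := anti _ _
      (by have := mul_nonneg hθ0.le he0; have := mul_nonneg (sub_nonneg.2 hθ1.le) hb; linarith) hc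
    have h3 := conv e b θ he0 hb hθ0.le hθ1.le
    have := mul_le_mul_of_nonneg_left hLe hθ0.le
    linarith
  · push Not at h1
    set g := d / (σ + 1) with hg
    have hgd : g * (σ + 1) = d := by rw [hg]; field_simp
    have hg0 : 0 ≤ g := by positivity
    set t := (1 - k) / σ with ht
    have htd : t * σ = 1 - k := by rw [ht]; field_simp
    have hP := hpow (σ + 1) (by linarith)
    rw [add_sub_cancel_right] at hP
    have hgt : g ≤ t := by
      rw [ht, le_div_iff₀ hσ0]; linarith
    have hta : t ≤ 1 / σ := by
      rw [ht]; gcongr; linarith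
    have hLtg := anti _ _ hg0 hgt
    have hLg : L g ≤ X := by
      have := mul_le_mul_of_nonneg_left hLtg hσ0.le
      linarith
    have hLa : L (1 / σ) ≤ X := (anti _ _ hg0 (hgt.trans hta)).trans hLg
    rcases le_or_gt b (1 / σ) with hba | hba
    · have := anti _ _ hb hba
      have h3 := mul_le_mul_of_nonneg_left hLa hθ0.le
      have h4 := mul_le_mul_of_nonneg_left this (sub_nonneg.2 hθ1.le)
      linarith
    · have hgb : 0 < b - g := by linarith
      set l := (b - t) / (b - g) with hl
      have hl0 : 0 ≤ l := div_nonneg (by linarith) hgb.le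
      have hl1 : l ≤ 1 := (div_le_one hgb).2 (by linarith)
      have hlt : l * g + (1 - l) * b = t := by rw [hl]; field_simp; ring
      have h2 := conv g b l hg0 hb hl0 hl1
      rw [hlt] at h2
      set D := 1 + σ * (1 - l) with hD
      have hD1 : 1 ≤ D := by
        have := mul_nonneg hσ0.le (sub_nonneg.2 hl1); linarith
      have h3 : D * L g ≤ X + (D - 1) * L b := by
        have := mul_le_mul_of_nonneg_left h2 hσ0.le
        rw [hD]; linarith
      set m := (b - 1 / σ) / (b - g) with hm
      have hm0 : 0 ≤ m := div_nonneg (by linarith) hgb.le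
      have hm1 : m ≤ 1 := (div_le_one hgb).2 (by linarith)
      have hma : m * g + (1 - m) * b = 1 / σ := by rw [hm]; field_simp; ring
      have h4 := conv g b m hg0 hb hm0 hm1
      rw [hma] at h4
      set p := m / D with hp
      have hpD : p * D = m := by rw [hp]; field_simp
      have hp0 : 0 ≤ p := by positivity
      have h5 : L (1 / σ) ≤ p * X + (1 - p) * L b := by
        have h6 : p * (D * L g) ≤ p * (X + (D - 1) * L b) := mul_le_mul_of_nonneg_left h3 hp0
        have h7 : m * L g = p * (D * L g) := by rw [← hpD]; ring
        have h8 : m * L b = p * D * L b := by rw [← hpD]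
        linarith
      have hge : e = D * g - (D - 1) * b := by
        have : σ * t = σ * (l * g + (1 - l) * b) := by rw [hlt]
        rw [hD]; linarith
      have hape : p * e + (1 - p) * b = 1 / σ := by
        rw [← hma, hge, ← hpD]; ring
      have hpθ : p ≤ θ := by
        have : 0 ≤ (θ - p) * (b - e) := by linarith
        by_contra hcon
        push Not at hcon
        have := mul_pos (sub_pos.2 hcon) (show 0 < b - e by linarith)
        linarith
      rcases le_total (L b) X with hXb | hXb
      · have := mul_nonneg (sub_nonneg.2 hpθ) (sub_nonneg.2 hXb)
        linarith
      · have := mul_nonneg (sub_nonneg.2 hθ1.le) (sub_nonneg.2 hXb)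
        linarith

theorem exists_orthonormalBasis_forall_sub_smul_mem_ball {n : ℕ} (hn : n ≠ 0)
    (x₀ : EuclideanSpace ℝ (Fin n)) :
    ∃ b : OrthonormalBasis (Fin n) ℝ (EuclideanSpace ℝ (Fin n)), ∃ U, IsOpen U ∧ x₀ ∈ U ∧
      ∃ τ : ℝ, 0 < τ ∧ ∀ x ∈ U ∩ ball 0 1, ∀ i, ∀ t ∈ Icc 0 τ,
        x - t • b i ∈ ball (0 : EuclideanSpace ℝ (Fin n)) 1 := by
  by_cases hx : x₀ = 0
  · subst hx
    refine ⟨EuclideanSpace.basisFun _ _, ball 0 (1 / 2), isOpen_ball, by simp, 1 / 2, by norm_num,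
      fun x hx i t ht => ?_⟩
    rw [mem_ball_zero_iff]
    have h1 : ‖x‖ < 1 / 2 := by simpa using hx.1
    calc _ ≤ ‖x‖ + ‖t • (EuclideanSpace.basisFun (Fin n) ℝ) i‖ := norm_sub_le _ _
      _ = ‖x‖ + t := by
        rw [norm_smul, OrthonormalBasis.norm_eq_one, Real.norm_of_nonneg ht.1, mul_one]
      _ < 1 := by linarith [ht.2]
  · set e := EuclideanSpace.basisFun (Fin n) ℝ with he
    have hn' : (0 : ℝ) < n := by positivity
    set v : EuclideanSpace ℝ (Fin n) := WithLp.toLp 2 (fun _ => ‖x₀‖ / √n) with hv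
    have hvn : ‖v‖ = ‖x₀‖ := by
      rw [EuclideanSpace.norm_eq]
      simp only [hv, Finset.sum_const, Finset.card_univ, Fintype.card_fin, nsmul_eq_mul,
        Real.norm_eq_abs, sq_abs, div_pow, Real.sq_sqrt hn'.le]
      rw [mul_div_cancel₀ _ hn'.ne', Real.sqrt_sq (norm_nonneg _)]
    set R := Submodule.reflection (Submodule.span ℝ {v - x₀})ᗮ with hR
    have hRv : R v = x₀ := Submodule.reflection_sub hvn
    set b := e.map R with hb
    have hin : ∀ i, inner ℝ x₀ (b i) = ‖x₀‖ / √n := by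
      intro i
      have h : inner ℝ x₀ (b i) = inner ℝ v (e i) := by
        rw [← LinearIsometryEquiv.inner_map_map R v, hRv, hb, OrthonormalBasis.map_apply]
      rw [h]
      simp [he, hv, EuclideanSpace.inner_single_right]
    have hpos : 0 < ‖x₀‖ / √n := div_pos (norm_pos_iff.2 hx) (Real.sqrt_pos.2 hn')
    refine ⟨b, ⋂ i, {x | ‖x₀‖ / √n / 2 < inner ℝ x (b i)},
      isOpen_iInter_of_finite fun i => isOpen_lt continuous_const (by fun_prop), ?_,
      ‖x₀‖ / √n, hpos, ?_⟩
    · simp only [mem_iInter, mem_ofPred_eq, hin]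
      intro i; linarith
    · intro x hx i t ht
      have h1 := mem_iInter.1 hx.1 i
      simp only [mem_ofPred_eq] at h1
      have h2 : ‖x‖ < 1 := by simpa using hx.2
      rw [mem_ball_zero_iff]
      refine lt_of_le_of_lt ?_ h2
      rw [← sq_le_sq₀ (norm_nonneg _) (norm_nonneg _), norm_sub_sq_real, norm_smul,
        OrthonormalBasis.norm_eq_one, inner_smul_right, mul_one, Real.norm_of_nonneg ht.1]
      have := mul_nonneg ht.1 (show 0 ≤ 2 * inner ℝ x (b i) - t by linarith [ht.2])
      nlinarith

theorem enorm_le_lintegral_line {E : Type*} [NormedAddCommGroup E] [NormedSpace ℝ E]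
    {v : E → ℝ} (hv : ContDiff ℝ 1 v) {B : Set E} {τ : ℝ} (hτ : 0 < τ) {x e : E} (he : ‖e‖ = 1)
    (hB : ∀ t ∈ Icc 0 τ, x - t • e ∈ B) :
    ‖v x‖ₑ ≤ ∫⁻ t : ℝ, B.indicator
      (fun y => ENNReal.ofReal τ⁻¹ * ‖v y‖ₑ + ‖fderiv ℝ v y‖ₑ) (x + t • e) := by
  set F := B.indicator (fun y => ENNReal.ofReal τ⁻¹ * ‖v y‖ₑ + ‖fderiv ℝ v y‖ₑ) with hF
  have hd : ∀ t : ℝ, HasDerivAt (fun t : ℝ => (1 - τ⁻¹ * t) * v (x - t • e))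
      (-τ⁻¹ * v (x - t • e) + (1 - τ⁻¹ * t) * fderiv ℝ v (x - t • e) (-e)) t := by
    intro t
    have h1 : HasDerivAt (fun t : ℝ => x - t • e) (-e) t := by
      simpa using ((hasDerivAt_id t).smul_const e).const_sub x
    have h2 : HasDerivAt (fun t : ℝ => v (x - t • e)) (fderiv ℝ v (x - t • e) (-e)) t :=
      ((hv.differentiable one_ne_zero) _).hasFDerivAt.comp_hasDerivAt t h1
    have h3 : HasDerivAt (fun t : ℝ => 1 - τ⁻¹ * t) (-τ⁻¹) t := by
      simpa using ((hasDerivAt_id t).const_mul τ⁻¹).const_sub 1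
    exact h3.mul h2
  have hcont : Continuous fun t : ℝ =>
      -τ⁻¹ * v (x - t • e) + (1 - τ⁻¹ * t) * fderiv ℝ v (x - t • e) (-e) := by
    have := hv.continuous
    have := hv.continuous_fderiv one_ne_zero
    fun_prop
  have hftc := intervalIntegral.integral_eq_sub_of_hasDerivAt (fun t _ => hd t)
    (hcont.intervalIntegrable 0 τ)
  have hvx : ‖v x‖ₑ = ‖∫ t in Ioc 0 τ,
      (-τ⁻¹ * v (x - t • e) + (1 - τ⁻¹ * t) * fderiv ℝ v (x - t • e) (-e))‖ₑ := by
    rw [← intervalIntegral.integral_of_le hτ.le, hftc]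
    simp [hτ.ne']
  calc ‖v x‖ₑ ≤ ∫⁻ t in Ioc 0 τ,
        ‖-τ⁻¹ * v (x - t • e) + (1 - τ⁻¹ * t) * fderiv ℝ v (x - t • e) (-e)‖ₑ := by
        rw [hvx]; exact enorm_integral_le_lintegral_enorm _
    _ ≤ ∫⁻ t in Ioc 0 τ, F (x + (-t) • e) := by
        refine setLIntegral_mono' measurableSet_Ioc fun t ht => ?_
        have hm := hB t ⟨ht.1.le, ht.2⟩
        rw [neg_smul, ← sub_eq_add_neg, hF, indicator_of_mem hm]
        refine (enorm_add_le _ _).trans ?_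
        gcongr
        · rw [enorm_mul, enorm_neg, Real.enorm_of_nonneg (by positivity)]
        · rw [enorm_mul]
          have h1 : ‖1 - τ⁻¹ * t‖ₑ ≤ 1 := by
            have h0 : 0 ≤ τ⁻¹ * t := mul_nonneg (by positivity) ht.1.le
            have h2 : τ⁻¹ * t ≤ 1 := by
              rw [inv_mul_le_iff₀ hτ]; linarith [ht.2]
            rw [Real.enorm_of_nonneg (by linarith)]
            exact ENNReal.ofReal_le_one.2 (by linarith)
          have h2 : ‖fderiv ℝ v (x - t • e) (-e)‖ₑ ≤ ‖fderiv ℝ v (x - t • e)‖ₑ := by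
            refine (ContinuousLinearMap.le_opENorm _ _).trans ?_
            have : ‖-e‖ₑ = 1 := by rw [enorm_neg, ← ofReal_norm, he, ENNReal.ofReal_one]
            rw [this, mul_one]
          calc _ ≤ 1 * ‖fderiv ℝ v (x - t • e)‖ₑ := mul_le_mul' h1 h2
            _ = _ := one_mul _
    _ ≤ ∫⁻ t : ℝ, F (x + (-t) • e) := setLIntegral_le_lintegral _ _
    _ = ∫⁻ t : ℝ, F (x + t • e) := lintegral_neg_eq_self (fun t : ℝ => F (x + t • e)) 

theorem lintegral_prod_line_le {n : ℕ} (hn : 2 ≤ n)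
    (b : OrthonormalBasis (Fin n) ℝ (EuclideanSpace ℝ (Fin n)))
    {F : EuclideanSpace ℝ (Fin n) → ℝ≥0∞} (hF : Measurable F) :
    ∫⁻ x, ∏ i, (∫⁻ t : ℝ, F (x + t • b i)) ^ ((1 : ℝ) / (n - 1)) ≤
      (∫⁻ x, F x) ^ ((n : ℝ) / (n - 1)) := by
  set Φ : (Fin n → ℝ) → EuclideanSpace ℝ (Fin n) := fun y => b.repr.symm (WithLp.toLp 2 y) with hΦ
  have hmp : MeasurePreserving Φ := b.measurePreserving_repr_symm.comp
    (PiLp.volume_preserving_toLp _)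
  have hemb : MeasurableEmbedding Φ := b.measurableEquiv.symm.measurableEmbedding.comp
    (MeasurableEquiv.toLp 2 (Fin n → ℝ)).measurableEmbedding
  have hn1 : (1 : ℝ) < n := by exact_mod_cast hn
  have hp : Real.HolderConjugate (Fintype.card (Fin n)) ((n : ℝ) / (n - 1)) := by
    rw [Fintype.card_fin]; exact Real.HolderConjugate.conjExponent hn1
  have key := lintegral_prod_lintegral_pow_le (fun _ : Fin n => (volume : Measure ℝ)) hp
    (hF.comp hmp.measurable)
  rw [← hmp.lintegral_comp_emb hemb, ← hmp.lintegral_comp_emb hemb]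
  rw [Fintype.card_fin] at key
  refine le_trans (le_of_eq ?_) key
  rw [← volume_pi]
  congr with y
  congr with i
  congr 1
  have hu : ∀ t, Φ (Function.update y i t) = Φ y + (t - y i) • b i := by
    intro t
    have : WithLp.toLp 2 (Function.update y i t) =
        WithLp.toLp 2 y + (t - y i) • EuclideanSpace.single i (1 : ℝ) := by
      ext j
      by_cases h : j = i
      · subst h; simp
      · simp [h]
    simp only [hΦ, this, map_add, map_smul, OrthonormalBasis.repr_symm_single]
  simp only [Function.comp, hu]
  rw [← lintegral_sub_right_eq_self _ (y i)]

theorem lintegral_line_eq {b : OrthonormalBasis (Fin 1) ℝ (EuclideanSpace ℝ (Fin 1))}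
    (F : EuclideanSpace ℝ (Fin 1) → ℝ≥0∞) (x : EuclideanSpace ℝ (Fin 1)) :
    ∫⁻ t : ℝ, F (x + t • b 0) = ∫⁻ y, F y := by
  set Φ : ℝ → EuclideanSpace ℝ (Fin 1) := fun t => b.repr.symm (WithLp.toLp 2 fun _ => t) with hΦ
  have hmp : MeasurePreserving Φ := b.measurePreserving_repr_symm.comp
    ((PiLp.volume_preserving_toLp _).comp (volume_preserving_funUnique (Fin 1) ℝ).symm)
  have hemb : MeasurableEmbedding Φ := b.measurableEquiv.symm.measurableEmbedding.comp
    ((MeasurableEquiv.toLp 2 (Fin 1 → ℝ)).measurableEmbedding.comp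
      (MeasurableEquiv.funUnique (Fin 1) ℝ).symm.measurableEmbedding)
  have hsmul : ∀ t, Φ t = t • b 0 := by
    intro t
    have : WithLp.toLp 2 (fun _ : Fin 1 => t) = t • EuclideanSpace.single 0 (1 : ℝ) := by
      ext j
      simp [Subsingleton.elim j 0]
    simp only [hΦ, this, map_smul, OrthonormalBasis.repr_symm_single]
  have hx : x = (b.repr x 0) • b 0 := by
    conv_lhs => rw [← b.sum_repr x]
    simp
  rw [← hmp.lintegral_comp_emb hemb]
  simp only [hsmul]
  rw [← lintegral_add_left_eq_self (fun t : ℝ => F (t • b 0)) (b.repr x 0)]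
  simp only [add_smul, ← hx]

theorem eLpNorm_restrict_union_le {α F : Type*} [MeasurableSpace α] [NormedAddCommGroup F]
    (f : α → F) {p : ℝ≥0∞} (hp : 1 ≤ p) (μ : Measure α) (s t : Set α) :
    eLpNorm f p (μ.restrict (s ∪ t)) ≤
      eLpNorm f p (μ.restrict s) + eLpNorm f p (μ.restrict t) := by
  rcases eq_or_ne p ⊤ with rfl | hpt
  · simp only [eLpNorm_exponent_top]
    refine eLpNormEssSup_le_of_ae_enorm_bound ?_
    rw [ae_restrict_union_iff]
    constructor
    · filter_upwards [enorm_ae_le_eLpNormEssSup f (μ.restrict s)] with x hx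
      exact hx.trans le_self_add
    · filter_upwards [enorm_ae_le_eLpNormEssSup f (μ.restrict t)] with x hx
      exact hx.trans le_add_self
  · have hp0 : p ≠ 0 := (zero_lt_one.trans_le hp).ne'
    have h1 : 1 ≤ p.toReal := by
      rw [← ENNReal.toReal_one]; exact ENNReal.toReal_mono hpt hp
    simp only [eLpNorm_eq_lintegral_rpow_enorm_toReal hp0 hpt]
    refine (ENNReal.rpow_le_rpow (lintegral_union_le _ s t) (by positivity)).trans ?_
    exact ENNReal.rpow_add_le_add_rpow _ _ (by positivity)
      ((div_le_one (by linarith)).2 h1)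

theorem exists_eLpNorm_ball_le {n : ℕ} (hn : n ≠ 0) :
    ∃ C : ℝ≥0∞, C ≠ ⊤ ∧ ∀ v : EuclideanSpace ℝ (Fin n) → ℝ, ContDiff ℝ 1 v →
      eLpNorm v (ENNReal.ofReal (1 - 1 / n))⁻¹ (volume.restrict (ball 0 1)) ≤
        C * ∫⁻ x in ball 0 1, (‖v x‖ₑ + ‖fderiv ℝ v x‖ₑ) := by
  have hn0 : (0 : ℝ) < n := by positivity
  have hκ : 1 ≤ (ENNReal.ofReal (1 - 1 / n))⁻¹ := by
    rw [ENNReal.one_le_inv]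
    exact ENNReal.ofReal_le_one.2 (by have : (0 : ℝ) < 1 / n := by positivity
                                      linarith)
  suffices h : ∃ C : ℝ≥0∞, C ≠ ⊤ ∧ ∀ v : EuclideanSpace ℝ (Fin n) → ℝ, ContDiff ℝ 1 v →
      eLpNorm v (ENNReal.ofReal (1 - 1 / n))⁻¹
        (volume.restrict (closedBall (0 : EuclideanSpace ℝ (Fin n)) 1 ∩ ball 0 1)) ≤
        C * ∫⁻ x in ball 0 1, (‖v x‖ₑ + ‖fderiv ℝ v x‖ₑ) by
    rwa [inter_eq_right.2 ball_subset_closedBall] at h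
  refine (isCompact_closedBall (0 : EuclideanSpace ℝ (Fin n)) 1).induction_on
    (p := fun s => ∃ C : ℝ≥0∞, C ≠ ⊤ ∧ ∀ v : EuclideanSpace ℝ (Fin n) → ℝ, ContDiff ℝ 1 v →
      eLpNorm v (ENNReal.ofReal (1 - 1 / n))⁻¹ (volume.restrict (s ∩ ball 0 1)) ≤
        C * ∫⁻ x in ball 0 1, (‖v x‖ₑ + ‖fderiv ℝ v x‖ₑ)) ?_ ?_ ?_ ?_
  · exact ⟨0, by simp, fun v _ => by simp⟩
  · rintro s t hst ⟨C, hC, h⟩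
    exact ⟨C, hC, fun v hv => (eLpNorm_mono_measure _ (Measure.restrict_mono
      (inter_subset_inter_left _ hst) le_rfl)).trans (h v hv)⟩
  · rintro s t ⟨C, hC, h⟩ ⟨C', hC', h'⟩
    refine ⟨C + C', ENNReal.add_ne_top.2 ⟨hC, hC'⟩, fun v hv => ?_⟩
    rw [union_inter_distrib_right, add_mul]
    exact (eLpNorm_restrict_union_le v hκ _ _ _).trans (add_le_add (h v hv) (h' v hv))
  · intro x₀ _
    obtain ⟨b, U, hU, hxU, τ, hτ, hb⟩ := exists_orthonormalBasis_forall_sub_smul_mem_ball hn x₀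
    refine ⟨U, mem_nhdsWithin_of_mem_nhds (hU.mem_nhds hxU), ENNReal.ofReal τ⁻¹ + 1, by simp,
      fun v hv => ?_⟩
    set F := (ball (0 : EuclideanSpace ℝ (Fin n)) 1).indicator
      (fun y => ENNReal.ofReal τ⁻¹ * ‖v y‖ₑ + ‖fderiv ℝ v y‖ₑ) with hF
    have hvc := hv.continuous
    have hvd := hv.continuous_fderiv one_ne_zero
    have hFm : Measurable F := by
      refine Measurable.indicator ?_ measurableSet_ball
      fun_prop
    have hline : ∀ x ∈ U ∩ ball 0 1, ∀ i, ‖v x‖ₑ ≤ ∫⁻ t : ℝ, F (x + t • b i) := fun x hx i =>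
      enorm_le_lintegral_line hv hτ (b.norm_eq_one i) (hb x hx i)
    have hFI : ∫⁻ x, F x ≤
        (ENNReal.ofReal τ⁻¹ + 1) * ∫⁻ x in ball 0 1, (‖v x‖ₑ + ‖fderiv ℝ v x‖ₑ) := by
      rw [hF, lintegral_indicator measurableSet_ball, ← lintegral_const_mul _ (by fun_prop)]
      refine lintegral_mono fun x => ?_
      simp only [mul_add, add_mul, one_mul]
      calc _ ≤ (ENNReal.ofReal τ⁻¹ * ‖v x‖ₑ + ‖fderiv ℝ v x‖ₑ) +
          (‖v x‖ₑ + ENNReal.ofReal τ⁻¹ * ‖fderiv ℝ v x‖ₑ) := le_self_add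
        _ = _ := by ring
    refine le_trans ?_ hFI
    have hms : MeasurableSet (U ∩ ball (0 : EuclideanSpace ℝ (Fin n)) 1) :=
      hU.measurableSet.inter measurableSet_ball
    rcases eq_or_ne n 1 with rfl | hn1
    · have : (ENNReal.ofReal (1 - 1 / (1 : ℕ)))⁻¹ = ⊤ := by simp
      rw [this, eLpNorm_exponent_top]
      refine eLpNormEssSup_le_of_ae_enorm_bound ?_
      filter_upwards [ae_restrict_mem hms] with x hx
      exact (hline x hx 0).trans (lintegral_line_eq F x).le
    · have hn2 : 2 ≤ n := by omega
      have hn1' : (1 : ℝ) < n := by exact_mod_cast hn2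
      have hd : 0 < 1 - 1 / (n : ℝ) := by
        rw [sub_pos, div_lt_one hn0]; exact hn1'
      have hκr : (ENNReal.ofReal (1 - 1 / n))⁻¹.toReal = (n : ℝ) / (n - 1) := by
        rw [ENNReal.toReal_inv, ENNReal.toReal_ofReal hd.le]
        have : (n : ℝ) - 1 ≠ 0 := by linarith
        field_simp
      rw [eLpNorm_eq_lintegral_rpow_enorm_toReal (zero_lt_one.trans_le hκ).ne'
        (by simpa using hd), hκr]
      rw [one_div, ENNReal.rpow_inv_le_iff (by apply div_pos <;> linarith)]
      refine le_trans ?_ (lintegral_prod_line_le hn2 b hFm)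
      refine le_trans (setLIntegral_mono' hms fun x hx => ?_) (setLIntegral_le_lintegral _ _)
      calc ‖v x‖ₑ ^ ((n : ℝ) / (n - 1)) = ∏ _i : Fin n, ‖v x‖ₑ ^ ((1 : ℝ) / (n - 1)) := by
            rw [Finset.prod_const, Finset.card_univ, Fintype.card_fin, ← ENNReal.rpow_mul_natCast]
            congr 1; ring
        _ ≤ _ := by
            refine Finset.prod_le_prod' fun i _ => ?_
            exact ENNReal.rpow_le_rpow (hline x hx i) (by
              apply div_nonneg <;> linarith)

theorem eLpNorm_mul_le_of_inv {α : Type*} [MeasurableSpace α] {μ : Measure α} {f g : α → ℝ}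
    (hf : AEStronglyMeasurable f μ) (hg : AEStronglyMeasurable g μ) {s t : ℝ} (hs : 0 ≤ s)
    (ht : 0 ≤ t) :
    eLpNorm (fun x => f x * g x) (ENNReal.ofReal (s + t))⁻¹ μ ≤
      eLpNorm f (ENNReal.ofReal s)⁻¹ μ * eLpNorm g (ENNReal.ofReal t)⁻¹ μ := by
  have : ENNReal.HolderTriple (ENNReal.ofReal s)⁻¹ (ENNReal.ofReal t)⁻¹
      (ENNReal.ofReal (s + t))⁻¹ := ⟨by simp [ENNReal.ofReal_add hs ht]⟩
  rw [show (fun x => f x * g x) = f • g from rfl]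
  exact eLpNorm_smul_le_mul_eLpNorm (p := (ENNReal.ofReal s)⁻¹) (q := (ENNReal.ofReal t)⁻¹) hg hf

theorem eLpNorm_norm_rpow_inv {α F : Type*} [MeasurableSpace α] {μ : Measure α}
    [NormedAddCommGroup F] (f : α → F) {p : ℝ} (hp : 0 < p) (t : ℝ) :
    eLpNorm (fun x => ‖f x‖ ^ p) (ENNReal.ofReal t)⁻¹ μ =
      eLpNorm f (ENNReal.ofReal (t / p))⁻¹ μ ^ p := by
  rw [eLpNorm_norm_rpow f hp, ENNReal.ofReal_div_of_pos hp,
    ENNReal.inv_div (Or.inl ENNReal.ofReal_ne_top) (Or.inl (by simpa using hp)),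
    ENNReal.div_eq_inv_mul]

theorem eLpNorm_interpolate {α : Type*} [MeasurableSpace α] {μ : Measure α} {f : α → ℝ}
    (hf : AEStronglyMeasurable f μ) {s t l m : ℝ} (hs : 0 ≤ s) (ht : 0 ≤ t) (hl : 0 ≤ l)
    (hm : 0 ≤ m) (hlm : l + m = 1) :
    eLpNorm f (ENNReal.ofReal (l * s + m * t))⁻¹ μ ≤
      eLpNorm f (ENNReal.ofReal s)⁻¹ μ ^ l * eLpNorm f (ENNReal.ofReal t)⁻¹ μ ^ m := by
  rcases hl.eq_or_lt with rfl | hl'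
  · obtain rfl : m = 1 := by linarith
    simp
  rcases hm.eq_or_lt with rfl | hm'
  · obtain rfl : l = 1 := by linarith
    simp
  have h1 := eLpNorm_norm_rpow_inv (μ := μ) f hl' (l * s)
  have h2 := eLpNorm_norm_rpow_inv (μ := μ) f hm' (m * t)
  rw [mul_div_cancel_left₀ _ hl'.ne'] at h1
  rw [mul_div_cancel_left₀ _ hm'.ne'] at h2
  rw [← h1, ← h2]
  refine le_trans (le_of_eq ?_) (eLpNorm_mul_le_of_inv (hf.norm.aemeasurable.pow_const l
    |>.aestronglyMeasurable) (hf.norm.aemeasurable.pow_const m |>.aestronglyMeasurable)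
    (mul_nonneg hl hs) (mul_nonneg hm ht))
  rw [← eLpNorm_norm f]
  congr with x
  rcases (norm_nonneg (f x)).eq_or_lt with h | h
  · rw [← h]; simp [Real.zero_rpow hl'.ne']
  · rw [← Real.rpow_add h, hlm, Real.rpow_one]

theorem lintegral_enorm_add_enorm_fderiv_norm_rpow_le {E : Type*} [NormedAddCommGroup E]
    [NormedSpace ℝ E] [MeasurableSpace E] [BorelSpace E] [FiniteDimensional ℝ E] {μ : Measure E}
    {u : E → ℝ} (hu : ContDiff ℝ 1 u) {γ k : ℝ} (hγ : 1 < γ) (hk0 : 0 ≤ k) (hk1 : k ≤ 1) :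
    ∫⁻ x, (‖‖u x‖ ^ γ‖ₑ + ‖fderiv ℝ (fun x => ‖u x‖ ^ γ) x‖ₑ) ∂μ ≤
      ENNReal.ofReal γ * (eLpNorm u (ENNReal.ofReal ((1 - k) / (γ - 1)))⁻¹ μ ^ (γ - 1) *
        eLpNorm (fun x => ‖u x‖ + ‖fderiv ℝ u x‖) (ENNReal.ofReal k)⁻¹ μ) := by
  have hγ1 : 0 < γ - 1 := by linarith
  have hc := hu.continuous
  have hd := hu.continuous_fderiv one_ne_zero
  have hcr : Continuous fun x => ‖u x‖ ^ (γ - 1) :=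
    hc.norm.rpow_const fun _ => Or.inr hγ1.le
  have hH := eLpNorm_mul_le_of_inv (μ := μ) (f := fun x => ‖u x‖ ^ (γ - 1))
    (g := fun x => ‖u x‖ + ‖fderiv ℝ u x‖) hcr.aestronglyMeasurable
    (by fun_prop) (sub_nonneg.2 hk1) hk0
  rw [eLpNorm_norm_rpow_inv u hγ1, sub_add_cancel, ENNReal.ofReal_one, inv_one,
    eLpNorm_one_eq_lintegral_enorm] at hH
  refine le_trans ?_ (mul_le_mul_right hH _)
  rw [← lintegral_const_mul' _ _ ENNReal.ofReal_ne_top]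
  refine lintegral_mono fun x => ?_
  have hb := norm_fderiv_norm_rpow_le (hu.differentiable one_ne_zero) (x := x) hγ
  have hpow : ‖u x‖ ^ γ = ‖u x‖ ^ (γ - 1) * ‖u x‖ := by
    rw [← Real.rpow_add_one' (norm_nonneg _) (by linarith), sub_add_cancel]
  have h0 : 0 ≤ ‖u x‖ ^ (γ - 1) := Real.rpow_nonneg (norm_nonneg _) _
  rw [← ofReal_norm, ← ofReal_norm, ← ofReal_norm, ← ENNReal.ofReal_add (norm_nonneg _)
    (norm_nonneg _), ← ENNReal.ofReal_mul (by linarith)]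
  refine ENNReal.ofReal_le_ofReal ?_
  rw [Real.norm_of_nonneg (Real.rpow_nonneg (norm_nonneg (u x)) γ),
    Real.norm_of_nonneg (mul_nonneg h0 (add_nonneg (norm_nonneg (u x)) (norm_nonneg _))), hpow]
  have := mul_nonneg (mul_nonneg hγ1.le h0) (norm_nonneg (u x))
  nlinarith

theorem exists_eLpNorm_normalized_ball_le {n : ℕ} (hn : n ≠ 0) :
    ∃ C : ℝ≥0∞, C ≠ ⊤ ∧ ∀ v : EuclideanSpace ℝ (Fin n) → ℝ, ContDiff ℝ 1 v →
      eLpNorm v (ENNReal.ofReal (1 - 1 / n))⁻¹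
          ((volume (ball (0 : EuclideanSpace ℝ (Fin n)) 1))⁻¹ • volume.restrict (ball 0 1)) ≤
        C * ∫⁻ x, (‖v x‖ₑ + ‖fderiv ℝ v x‖ₑ)
          ∂((volume (ball (0 : EuclideanSpace ℝ (Fin n)) 1))⁻¹ • volume.restrict (ball 0 1)) := by
  obtain ⟨C, hC, h⟩ := exists_eLpNorm_ball_le hn
  set V := volume (ball (0 : EuclideanSpace ℝ (Fin n)) 1) with hV
  have hV0 : V ≠ 0 := (measure_ball_pos _ _ one_pos).ne'
  have hVt : V ≠ ⊤ := measure_ball_lt_top.ne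
  set a : ℝ≥0∞ := V⁻¹ ^ (1 / (ENNReal.ofReal (1 - 1 / n))⁻¹).toReal with ha
  have hat : a ≠ ⊤ := ENNReal.rpow_ne_top_of_nonneg ENNReal.toReal_nonneg (by simpa using hV0)
  refine ⟨a * C * V, ENNReal.mul_ne_top (ENNReal.mul_ne_top hat hC) hVt, fun v hv => ?_⟩
  rw [eLpNorm_smul_measure_of_ne_zero (by simpa using hVt), lintegral_smul_measure, smul_eq_mul,
    smul_eq_mul, ← ha, mul_assoc, ← mul_assoc V, ENNReal.mul_inv_cancel hV0 hVt, one_mul, mul_assoc]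
  exact mul_le_mul_right (h v hv) _

theorem Continuous.memLp_normalized_ball {n : ℕ} {F : Type*} [NormedAddCommGroup F]
    {f : EuclideanSpace ℝ (Fin n) → F} (hf : Continuous f) (p : ℝ≥0∞) :
    MemLp f p
      ((volume (ball (0 : EuclideanSpace ℝ (Fin n)) 1))⁻¹ • volume.restrict (ball 0 1)) := by
  have hV0 : volume (ball (0 : EuclideanSpace ℝ (Fin n)) 1) ≠ 0 :=
    (measure_ball_pos _ _ one_pos).ne'
  refine MemLp.smul_measure ?_ (by simpa using hV0)
  obtain ⟨M, hM⟩ := (isCompact_closedBall (0 : EuclideanSpace ℝ (Fin n)) 1).exists_bound_of_continuousOn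
    hf.continuousOn
  have : IsFiniteMeasure (volume.restrict (ball (0 : EuclideanSpace ℝ (Fin n)) 1)) :=
    ⟨by simpa using measure_ball_lt_top⟩
  refine MemLp.of_bound hf.aestronglyMeasurable M ?_
  filter_upwards [ae_restrict_mem measurableSet_ball] with x hx
  exact hM x (ball_subset_closedBall hx)

theorem exists_gagliardo_nirenberg_normalized_ball {n : ℕ} (hn : n ≠ 0) {σ : ℝ} (hσ : 1 ≤ σ) :
    ∃ C : ℝ, 1 ≤ C ∧ ∀ (k b θ : ℝ), 0 < k → k ≤ 1 → 0 ≤ b → 0 < θ → θ < 1 →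
      θ * (k - 1 / n) + (1 - θ) * b ≤ 1 / σ →
      ∀ u : EuclideanSpace ℝ (Fin n) → ℝ, ContDiff ℝ 1 u →
        (eLpNorm u (ENNReal.ofReal (1 / σ))⁻¹ ((volume (ball (0 : EuclideanSpace ℝ (Fin n)) 1))⁻¹ •
          volume.restrict (ball 0 1))).toReal ≤
        C * (eLpNorm (fun x => ‖u x‖ + ‖fderiv ℝ u x‖) (ENNReal.ofReal k)⁻¹
          ((volume (ball (0 : EuclideanSpace ℝ (Fin n)) 1))⁻¹ •
            volume.restrict (ball 0 1))).toReal ^ θ *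
        (eLpNorm u (ENNReal.ofReal b)⁻¹ ((volume (ball (0 : EuclideanSpace ℝ (Fin n)) 1))⁻¹ •
          volume.restrict (ball 0 1))).toReal ^ (1 - θ) := by
  obtain ⟨C, hC, hsob⟩ := exists_eLpNorm_normalized_ball_le hn
  set μ := (volume (ball (0 : EuclideanSpace ℝ (Fin n)) 1))⁻¹ •
    (volume : Measure (EuclideanSpace ℝ (Fin n))).restrict (ball 0 1) with hμ
  have hprob : IsProbabilityMeasure μ := by
    refine ⟨?_⟩
    rw [hμ, Measure.smul_apply, Measure.restrict_apply_univ, smul_eq_mul]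
    exact ENNReal.inv_mul_cancel (measure_ball_pos _ _ one_pos).ne' measure_ball_lt_top.ne
  set A := max C.toReal 1 with hA
  have hA1 : 1 ≤ A := le_max_right _ _
  have hCA : C ≤ ENNReal.ofReal A := (ENNReal.le_ofReal_iff_toReal_le hC (by linarith)).2
    (le_max_left _ _)
  have hA0 : 0 < A := by linarith
  have hAσ : 1 ≤ A * (σ + 1) := by nlinarith
  refine ⟨A * (σ + 1), hAσ, fun k b θ hk0 hk1 hb hθ0 hθ1 hcond u hu => ?_⟩
  set g : EuclideanSpace ℝ (Fin n) → ℝ := fun x => ‖u x‖ + ‖fderiv ℝ u x‖ with hg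
  have hgc : Continuous g := by
    have := hu.continuous
    have := hu.continuous_fderiv one_ne_zero
    fun_prop
  set N : ℝ → ℝ≥0∞ := fun t => eLpNorm u (ENNReal.ofReal t)⁻¹ μ with hN
  set W := eLpNorm g (ENNReal.ofReal k)⁻¹ μ with hW
  change (N (1 / σ)).toReal ≤ A * (σ + 1) * W.toReal ^ θ * (N b).toReal ^ (1 - θ)
  have hNt : ∀ t, N t ≠ ⊤ := fun t => (hu.continuous.memLp_normalized_ball _).eLpNorm_ne_top
  have hWt : W ≠ ⊤ := (hgc.memLp_normalized_ball _).eLpNorm_ne_top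
  have hexp : ∀ t : ℝ, (ENNReal.ofReal t)⁻¹ ≠ 0 := fun t => by simp
  have hum : AEStronglyMeasurable u μ := hu.continuous.aestronglyMeasurable
  by_cases hz : N (1 / σ) = 0
  · rw [hz]
    have : 0 ≤ W.toReal := ENNReal.toReal_nonneg
    have : 0 ≤ (N b).toReal := ENNReal.toReal_nonneg
    simp only [ENNReal.toReal_zero]
    positivity
  have hune : ¬ u =ᵐ[μ] 0 := fun h => hz ((eLpNorm_eq_zero_iff hum (hexp _)).2 h)
  have hN0 : ∀ t, N t ≠ 0 := fun t h => hune ((eLpNorm_eq_zero_iff hum (hexp _)).1 h)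
  have hNpos : ∀ t, 0 < (N t).toReal := fun t => ENNReal.toReal_pos (hN0 t) (hNt t)
  have hW0 : W ≠ 0 := by
    have : N k ≤ W := eLpNorm_mono fun x => by
      rw [Real.norm_of_nonneg (by positivity : 0 ≤ g x)]
      exact le_add_of_nonneg_right (norm_nonneg _)
    exact fun h => hN0 k (le_zero_iff.1 (h ▸ this))
  have hWpos : 0 < W.toReal := ENNReal.toReal_pos hW0 hWt
  have hlogconv : ConvexOn ℝ (Ici 0) fun t => Real.log (N t).toReal := by
    refine ⟨convex_Ici 0, fun x hx y hy l m hl hm hlm => ?_⟩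
    have h := ENNReal.toReal_mono (ENNReal.mul_ne_top
      (ENNReal.rpow_ne_top_of_nonneg hl (hNt x)) (ENNReal.rpow_ne_top_of_nonneg hm (hNt y)))
      (eLpNorm_interpolate hum hx hy hl hm hlm)
    rw [ENNReal.toReal_mul, ← ENNReal.toReal_rpow, ← ENNReal.toReal_rpow] at h
    have h2 := Real.log_le_log (hNpos _) h
    rw [Real.log_mul (Real.rpow_pos_of_pos (hNpos x) _).ne'
      (Real.rpow_pos_of_pos (hNpos y) _).ne', Real.log_rpow (hNpos x),
      Real.log_rpow (hNpos y)] at h2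
    exact h2
  have hloganti : AntitoneOn (fun t => Real.log (N t).toReal) (Ici 0) := by
    intro x _ y _ hxy
    refine Real.log_le_log (hNpos _) (ENNReal.toReal_mono (hNt _) ?_)
    exact eLpNorm_le_eLpNorm_of_exponent_le
      (ENNReal.inv_le_inv.2 (ENNReal.ofReal_le_ofReal hxy)) hum
  have hd : (0 : ℝ) ≤ 1 - 1 / n := by
    have : (1 : ℝ) ≤ n := by exact_mod_cast Nat.one_le_iff_ne_zero.2 hn
    rw [sub_nonneg]
    exact (div_le_one (by linarith)).2 this
  have hone : Real.log (N (1 - 1 / n)).toReal ≤ Real.log A + Real.log W.toReal := by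
    rw [← Real.log_mul hA0.ne' hWpos.ne']
    refine Real.log_le_log (hNpos _) ?_
    have h : N (1 - 1 / n) ≤ ENNReal.ofReal A * W := by
      refine (hsob u hu).trans (mul_le_mul' hCA ?_)
      have h1 : ∫⁻ x, (‖u x‖ₑ + ‖fderiv ℝ u x‖ₑ) ∂μ = eLpNorm g 1 μ := by
        rw [eLpNorm_one_eq_lintegral_enorm]
        refine lintegral_congr fun x => ?_
        rw [Real.enorm_of_nonneg (by positivity : 0 ≤ g x), hg,
          ENNReal.ofReal_add (norm_nonneg _) (norm_nonneg _), ofReal_norm, ofReal_norm]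
      rw [h1]
      refine eLpNorm_le_eLpNorm_of_exponent_le ?_ hgc.aestronglyMeasurable
      rw [ENNReal.one_le_inv]
      exact ENNReal.ofReal_le_one.2 hk1
    have := ENNReal.toReal_mono (ENNReal.mul_ne_top ENNReal.ofReal_ne_top hWt) h
    rwa [ENNReal.toReal_mul, ENNReal.toReal_ofReal hA0.le] at this
  have hpow : ∀ γ, 1 < γ → γ * Real.log (N ((1 - 1 / n) / γ)).toReal ≤ Real.log A + Real.log γ +
      (γ - 1) * Real.log (N ((1 - k) / (γ - 1))).toReal + Real.log W.toReal := by
    intro γ hγ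
    have hγ0 : 0 < γ := by linarith
    have h := (hsob _ (hu.norm_rpow hγ)).trans (mul_le_mul' hCA
      (lintegral_enorm_add_enorm_fderiv_norm_rpow_le hu hγ hk0.le hk1))
    rw [eLpNorm_norm_rpow_inv u hγ0] at h
    change N _ ^ γ ≤ ENNReal.ofReal A * (ENNReal.ofReal γ * (N _ ^ (γ - 1) * W)) at h
    have h2 := ENNReal.toReal_mono (ENNReal.mul_ne_top ENNReal.ofReal_ne_top
      (ENNReal.mul_ne_top ENNReal.ofReal_ne_top (ENNReal.mul_ne_top
        (ENNReal.rpow_ne_top_of_nonneg (by linarith) (hNt _)) hWt))) h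
    rw [ENNReal.toReal_mul, ENNReal.toReal_mul, ENNReal.toReal_mul, ← ENNReal.toReal_rpow,
      ← ENNReal.toReal_rpow, ENNReal.toReal_ofReal hA0.le, ENNReal.toReal_ofReal hγ0.le] at h2
    have h3 := Real.log_le_log (Real.rpow_pos_of_pos (hNpos _) _) h2
    have hp := Real.rpow_pos_of_pos (hNpos ((1 - k) / (γ - 1))) (γ - 1)
    rw [Real.log_mul hA0.ne' (by positivity), Real.log_mul hγ0.ne' (by positivity),
      Real.log_mul hp.ne' hWpos.ne', Real.log_rpow (hNpos _), Real.log_rpow (hNpos _)] at h3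
    linarith
  have key := le_of_convexOn_of_antitoneOn_of_sobolev hlogconv hloganti hd hσ hk0 hk1 hb hθ0 hθ1
    hone hpow (by linarith)
  have hWp := Real.rpow_pos_of_pos hWpos θ
  have hNp := Real.rpow_pos_of_pos (hNpos b) (1 - θ)
  rw [← Real.log_le_log_iff (hNpos _) (by positivity), Real.log_mul (by positivity) hNp.ne',
    Real.log_mul (by positivity) hWp.ne', Real.log_rpow hWpos, Real.log_rpow (hNpos _),
    Real.log_mul hA0.ne' (by positivity)]
  have h0 : 0 ≤ Real.log A + Real.log (σ + 1) := by
    rw [← Real.log_mul hA0.ne' (by positivity)]; exact Real.log_nonneg hAσ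
  have := mul_nonneg (sub_nonneg.2 hθ1.le) h0
  linarith

theorem setAverage_ball_eq_integral_normalized {n : ℕ} (x₀ : EuclideanSpace ℝ (Fin n)) {ρ : ℝ}
    (hρ : 0 < ρ) (f : EuclideanSpace ℝ (Fin n) → ℝ) :
    ⨍ x in ball x₀ ρ, f x = ∫ y, f (x₀ + ρ • y)
      ∂((volume (ball (0 : EuclideanSpace ℝ (Fin n)) 1))⁻¹ • volume.restrict (ball 0 1)) := by
  have h1 : ∫ y in ball 0 1, f (x₀ + ρ • y) = (ρ ^ n)⁻¹ * ∫ x in ball x₀ ρ, f x := by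
    rw [← integral_indicator measurableSet_ball, ← integral_indicator measurableSet_ball]
    have h2 : ∀ y, (ball (0 : EuclideanSpace ℝ (Fin n)) 1).indicator (fun y => f (x₀ + ρ • y)) y =
        (ball x₀ ρ).indicator f (x₀ + ρ • y) := by
      intro y
      have : y ∈ ball (0 : EuclideanSpace ℝ (Fin n)) 1 ↔ x₀ + ρ • y ∈ ball x₀ ρ := by
        rw [mem_ball_zero_iff, mem_ball_iff_norm, add_sub_cancel_left, norm_smul,
          Real.norm_of_nonneg hρ.le, mul_lt_iff_lt_one_right hρ]
      by_cases h : y ∈ ball (0 : EuclideanSpace ℝ (Fin n)) 1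
      · rw [indicator_of_mem h, indicator_of_mem (this.1 h)]
      · rw [indicator_of_notMem h, indicator_of_notMem (this.not.1 h)]
    simp_rw [h2]
    rw [Measure.integral_comp_smul volume (fun y => (ball x₀ ρ).indicator f (x₀ + y)) ρ,
      integral_add_left_eq_self (fun y => (ball x₀ ρ).indicator f y) x₀, finrank_euclideanSpace,
      Fintype.card_fin, abs_of_pos (by positivity), smul_eq_mul]
  rw [setAverage_eq, integral_smul_measure, h1, smul_eq_mul, smul_eq_mul, measureReal_def,
    Measure.addHaar_ball_of_pos _ _ hρ, finrank_euclideanSpace, Fintype.card_fin, ENNReal.toReal_mul,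
    ENNReal.toReal_ofReal (by positivity), ENNReal.toReal_inv, mul_inv]
  ring

theorem toReal_eLpNorm_normalized_ball {n : ℕ} {f : EuclideanSpace ℝ (Fin n) → ℝ}
    (hf : Continuous f) {p : ℝ} (hp : 1 ≤ p) :
    (eLpNorm f (ENNReal.ofReal (1 / p))⁻¹ ((volume (ball (0 : EuclideanSpace ℝ (Fin n)) 1))⁻¹ •
      volume.restrict (ball 0 1))).toReal =
    (∫ y, |f y| ^ p ∂((volume (ball (0 : EuclideanSpace ℝ (Fin n)) 1))⁻¹ •
      volume.restrict (ball 0 1))) ^ (1 / p) := by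
  have hp0 : 0 < p := by linarith
  have he : (ENNReal.ofReal (1 / p))⁻¹ = ENNReal.ofReal p := by
    rw [one_div, ENNReal.ofReal_inv_of_pos hp0, inv_inv]
  rw [he, (hf.memLp_normalized_ball _).eLpNorm_eq_integral_rpow_norm (by simpa using hp0) (by simp),
    ENNReal.toReal_ofReal hp0.le, ENNReal.toReal_ofReal
      (Real.rpow_nonneg (integral_nonneg fun _ => Real.rpow_nonneg (norm_nonneg _) _) _), one_div]
  simp only [Real.norm_eq_abs]

theorem add_rpow_le_two_rpow_mul {a b p : ℝ} (ha : 0 ≤ a) (hb : 0 ≤ b) (hp : 0 ≤ p) :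
    (a + b) ^ p ≤ 2 ^ p * (a ^ p + b ^ p) := by
  have h : (a + b) ^ p ≤ (2 * max a b) ^ p := by
    gcongr
    linarith [le_max_left a b, le_max_right a b]
  rw [Real.mul_rpow zero_le_two (ha.trans (le_max_left _ _))] at h
  refine h.trans (mul_le_mul_of_nonneg_left ?_ (by positivity))
  rcases max_cases a b with h | h <;> rw [h.1]
  · exact le_add_of_nonneg_right (by positivity)
  · exact le_add_of_nonneg_left (by positivity)

theorem toReal_eLpNorm_norm_add_norm_fderiv_le {n : ℕ} {u : EuclideanSpace ℝ (Fin n) → ℝ}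
    (hu : ContDiff ℝ 1 u) {q : ℝ} (hq : 1 ≤ q) :
    (eLpNorm (fun x => ‖u x‖ + ‖fderiv ℝ u x‖) (ENNReal.ofReal (1 / q))⁻¹
      ((volume (ball (0 : EuclideanSpace ℝ (Fin n)) 1))⁻¹ • volume.restrict (ball 0 1))).toReal ≤
    2 * (∫ y, (|u y| ^ q + ‖fderiv ℝ u y‖ ^ q)
      ∂((volume (ball (0 : EuclideanSpace ℝ (Fin n)) 1))⁻¹ •
        volume.restrict (ball 0 1))) ^ (1 / q) := by
  have hq0 : 0 < q := by linarith
  have hc := hu.continuous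
  have hd := hu.continuous_fderiv one_ne_zero
  have hint : Continuous fun y => |u y| ^ q + ‖fderiv ℝ u y‖ ^ q :=
    (hc.abs.rpow_const fun _ => Or.inr hq0.le).add (hd.norm.rpow_const fun _ => Or.inr hq0.le)
  have hint' : Continuous fun y => |‖u y‖ + ‖fderiv ℝ u y‖| ^ q :=
    (hc.norm.add hd.norm).abs.rpow_const fun _ => Or.inr hq0.le
  rw [toReal_eLpNorm_normalized_ball (by fun_prop) hq]
  calc _ ≤ (2 ^ q * ∫ y, (|u y| ^ q + ‖fderiv ℝ u y‖ ^ q)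
      ∂((volume (ball (0 : EuclideanSpace ℝ (Fin n)) 1))⁻¹ •
        volume.restrict (ball 0 1))) ^ (1 / q) := by
        refine Real.rpow_le_rpow (integral_nonneg fun _ => by positivity) ?_ (by positivity)
        rw [← integral_const_mul]
        refine integral_mono (memLp_one_iff_integrable.1 (hint'.memLp_normalized_ball 1))
          ((memLp_one_iff_integrable.1 (hint.memLp_normalized_ball 1)).const_mul _) fun y => ?_
        dsimp only
        rw [abs_of_nonneg (by positivity), ← Real.norm_eq_abs]
        exact add_rpow_le_two_rpow_mul (norm_nonneg _) (norm_nonneg _) hq0.le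
    _ = _ := by
        rw [Real.mul_rpow (by positivity) (integral_nonneg fun _ => by positivity),
          ← Real.rpow_mul zero_le_two, mul_one_div_cancel hq0.ne', Real.rpow_one]

theorem gagliardo_nirenberg_on_balls_of_subsingleton {E : Type*} [NormedAddCommGroup E]
    [NormedSpace ℝ E] [Subsingleton E] [MeasurableSpace E] {μ : Measure E}
    {σ q r θ ρ : ℝ} (hσ : 1 ≤ σ) (hq : 1 ≤ q) (hr : 1 ≤ r) (hθ0 : 0 < θ) (hθ1 : θ < 1)
    (hρ : 0 < ρ) (u : E → ℝ) {B : Set E} (hB0 : μ B ≠ 0) (hBt : μ B ≠ ⊤) :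
    ⨍ x in B, |u x| ^ σ / ρ ^ σ ∂μ ≤
      (⨍ x in B, (|u x| ^ q / ρ ^ q + ‖fderiv ℝ u x‖ ^ q) ∂μ) ^ (θ * σ / q)
        * (⨍ x in B, |u x| ^ r / ρ ^ r ∂μ) ^ ((1 - θ) * σ / r) := by
  have hav : ∀ f : E → ℝ, ⨍ x in B, f x ∂μ = f 0 := by
    intro f
    rw [show f = fun _ => f 0 from funext fun x => by rw [Subsingleton.elim x 0]]
    exact setAverage_const hB0 hBt _
  simp only [hav, ← Real.div_rpow (abs_nonneg _) hρ.le]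
  set a := |u 0| / ρ with ha
  have ha0 : 0 ≤ a := by positivity
  have hθ1' : 0 < 1 - θ := by linarith
  calc a ^ σ = (a ^ q) ^ (θ * σ / q) * (a ^ r) ^ ((1 - θ) * σ / r) := by
        rw [← Real.rpow_mul ha0, ← Real.rpow_mul ha0, mul_div_cancel₀ _ (by linarith),
          mul_div_cancel₀ _ (by linarith), ← Real.rpow_add_of_nonneg ha0 (by positivity)
          (by positivity)]
        congr 1; ring
    _ ≤ _ := by
        gcongr
        exact le_add_of_nonneg_right (by positivity)

/-- Gagliardo–Nirenberg interpolation inequality on balls (Lemma 2.9), stated for `C¹`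
functions: for `1 ≤ σ, q, r < ∞` and `θ ∈ (0,1)` with
`-n/σ ≤ θ (1 - n/q) - (1-θ) n/r`, there is a constant `c = c(n, σ) > 0` such that for
every ball `B_ρ(x₀) ⊆ ℝⁿ` and every `C¹` function `u` with the appropriate integrability,
`⨍_{B_ρ(x₀)} |u|^σ/ρ^σ ≤ c (⨍_{B_ρ(x₀)} (|u|^q/ρ^q + |Du|^q))^{θσ/q}
  (⨍_{B_ρ(x₀)} |u|^r/ρ^r)^{(1-θ)σ/r}`. -/
theorem gagliardo_nirenberg_on_balls (n : ℕ) (σ : ℝ) (hσ : 1 ≤ σ) :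
    ∃ c : ℝ, 0 < c ∧
      ∀ (q r θ : ℝ), 1 ≤ q → 1 ≤ r → 0 < θ → θ < 1 →
        -(n / σ) ≤ θ * (1 - n / q) - (1 - θ) * (n / r) →
        ∀ (x₀ : EuclideanSpace ℝ (Fin n)) (ρ : ℝ), 0 < ρ →
          ∀ u : EuclideanSpace ℝ (Fin n) → ℝ, ContDiff ℝ 1 u →
            IntegrableOn (fun x => |u x| ^ σ) (ball x₀ ρ) →
            IntegrableOn (fun x => |u x| ^ q) (ball x₀ ρ) →
            IntegrableOn (fun x => ‖fderiv ℝ u x‖ ^ q) (ball x₀ ρ) →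
            IntegrableOn (fun x => |u x| ^ r) (ball x₀ ρ) →
            ⨍ x in ball x₀ ρ, |u x| ^ σ / ρ ^ σ ≤
              c * (⨍ x in ball x₀ ρ, (|u x| ^ q / ρ ^ q + ‖fderiv ℝ u x‖ ^ q)) ^ (θ * σ / q)
                * (⨍ x in ball x₀ ρ, |u x| ^ r / ρ ^ r) ^ ((1 - θ) * σ / r) := by
  have hσ0 : 0 < σ := by linarith
  rcases eq_or_ne n 0 with rfl | hn
  · refine ⟨1, one_pos, fun q r θ hq hr hθ0 hθ1 _ x₀ ρ hρ u _ _ _ _ _ => ?_⟩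
    rw [one_mul]
    exact gagliardo_nirenberg_on_balls_of_subsingleton hσ hq hr hθ0 hθ1 hρ u
      (measure_ball_pos _ _ hρ).ne' measure_ball_lt_top.ne
  obtain ⟨C, hC1, hC⟩ := exists_gagliardo_nirenberg_normalized_ball hn hσ
  have hC0 : 0 < C := by linarith
  refine ⟨(C * 2) ^ σ, by positivity, fun q r θ hq hr hθ0 hθ1 hcond x₀ ρ hρ u hu _ _ _ _ => ?_⟩
  have hn0 : (0 : ℝ) < n := by positivity
  have hq0 : 0 < q := by linarith
  have hr0 : 0 < r := by linarith
  have hθ1' : 0 < 1 - θ := by linarith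
  set w : EuclideanSpace ℝ (Fin n) → ℝ := fun y => ρ⁻¹ * u (x₀ + ρ • y) with hw
  have hwc : ContDiff ℝ 1 w := by fun_prop
  have hwd : ∀ y, fderiv ℝ w y = fderiv ℝ u (x₀ + ρ • y) := by
    intro y
    have h1 : HasFDerivAt (fun y : EuclideanSpace ℝ (Fin n) => x₀ + ρ • y)
        (ρ • ContinuousLinearMap.id ℝ _) y := ((hasFDerivAt_id y).const_smul ρ).const_add x₀
    have h2 := (((hu.differentiable one_ne_zero) (x₀ + ρ • y)).hasFDerivAt.comp y h1).const_mul ρ⁻¹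
    refine HasFDerivAt.fderiv (h2.congr_fderiv ?_)
    ext z
    simp [hρ.ne']
  have hwa : ∀ (p : ℝ) y, |u (x₀ + ρ • y)| ^ p / ρ ^ p = |w y| ^ p := by
    intro p y
    rw [hw, abs_mul, abs_of_pos (inv_pos.2 hρ), ← Real.div_rpow (abs_nonneg _) hρ.le, div_eq_inv_mul]
  simp only [setAverage_ball_eq_integral_normalized x₀ hρ, hwa, ← hwd]
  have hmain := hC (1 / q) (1 / r) θ (by positivity) ((div_le_one hq0).2 hq) (by positivity) hθ0 hθ1
    (by
      rw [← mul_le_mul_iff_right₀ hn0]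
      have e1 : (n : ℝ) * (θ * (1 / q - 1 / n) + (1 - θ) * (1 / r)) =
          -(θ * (1 - n / q) - (1 - θ) * (n / r)) := by field_simp; ring
      rw [e1, mul_one_div]; linarith) w hwc
  have hW := toReal_eLpNorm_norm_add_norm_fderiv_le hwc hq
  rw [toReal_eLpNorm_normalized_ball hwc.continuous hσ,
    toReal_eLpNorm_normalized_ball hwc.continuous hr] at hmain
  set μ := (volume (ball (0 : EuclideanSpace ℝ (Fin n)) 1))⁻¹ •
    (volume : Measure (EuclideanSpace ℝ (Fin n))).restrict (ball 0 1) with hμ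
  set S := ∫ y, |w y| ^ σ ∂μ with hS
  set Q := ∫ y, (|w y| ^ q + ‖fderiv ℝ w y‖ ^ q) ∂μ with hQ
  set T := ∫ y, |w y| ^ r ∂μ with hT
  have hS0 : 0 ≤ S := integral_nonneg fun _ => by positivity
  have hQ0 : 0 ≤ Q := integral_nonneg fun _ => by positivity
  have hT0 : 0 ≤ T := integral_nonneg fun _ => by positivity
  have h1 : S ^ (1 / σ) ≤ (C * 2) * Q ^ (θ / q) * T ^ ((1 - θ) / r) := by
    have h2 : (2 * Q ^ (1 / q)) ^ θ ≤ 2 * Q ^ (θ / q) := by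
      rw [Real.mul_rpow zero_le_two (by positivity), ← Real.rpow_mul hQ0, one_div_mul_eq_div]
      gcongr
      exact Real.rpow_le_self_of_one_le one_le_two hθ1.le
    calc S ^ (1 / σ) ≤ _ := hmain
      _ ≤ C * (2 * Q ^ (1 / q)) ^ θ * (T ^ (1 / r)) ^ (1 - θ) := by gcongr
      _ ≤ C * (2 * Q ^ (θ / q)) * (T ^ (1 / r)) ^ (1 - θ) := by gcongr
      _ = _ := by rw [← Real.rpow_mul hT0, one_div_mul_eq_div]; ring
  calc S = (S ^ (1 / σ)) ^ σ := by
        rw [← Real.rpow_mul hS0, one_div_mul_cancel hσ0.ne', Real.rpow_one]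
    _ ≤ ((C * 2) * Q ^ (θ / q) * T ^ ((1 - θ) / r)) ^ σ := by gcongr
    _ = _ := by
        rw [Real.mul_rpow (by positivity) (by positivity), Real.mul_rpow (by positivity)
          (by positivity), ← Real.rpow_mul hQ0, ← Real.rpow_mul hT0, div_mul_eq_mul_div,
          div_mul_eq_mul_div]
end

section
/- Let n ≥ 1, let E^t ⊆ ℝⁿ for each t ∈ [0,T) be a family of sets with ℝⁿ \ E^t nonempty for each t, let M ≥ 1, β ∈ (1/2, 1], and suppose that for all s, t ∈ [0,T) and every x ∈ ℝⁿ \ E^t there exists y ∈ ℝⁿ \ E^s with |x − y| ≤ M·|t−s|^β. Let λ > 0, p ∈ ℝ, x_o ∈ ℝⁿ, t_o ∈ ℝ, and let ρ > 0 satisfy ρ ≤ ( min{1, λ^{(p−2)β}} / (2^{7β−3} M) )^{1/(2β−1)}. If there exists s ∈ (t_o − λ^{2−p}(8ρ)², t_o + λ^{2−p}(8ρ)²) ∩ (0,T) with B_{8ρ}(x_o) \ E^s ≠ ∅, then B_{16ρ}(x_o) \ E^t ≠ ∅ for every t ∈ (t_o − λ^{2−p}(8ρ)², t_o + λ^{2−p}(8ρ)²)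 ∩ (0,T). -/
open Set Metric

/-- Lemma 4.1: if the family of time slices `E^t` satisfies the two-sided growth condition
with constant `M ≥ 1` and exponent `β ∈ (1/2, 1]`, the radius `ρ` satisfies the smallness
condition (2.4), and `B_{8ρ}(x₀)` intersects the complement of `E^s` for some time
`s ∈ Λ_{8ρ}^{(λ)}(t₀) ∩ (0, T)`, then `B_{16ρ}(x₀)` intersects the complement of `E^t`
for every `t ∈ Λ_{8ρ}^{(λ)}(t₀) ∩ (0, T)`. -/
theorem ball_complement_intersect
    (n : ℕ) (hn : 1 ≤ n) (T : ℝ)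
    (E : ℝ → Set (EuclideanSpace ℝ (Fin n)))
    (hne : ∀ t ∈ Ico (0 : ℝ) T, ((E t)ᶜ : Set (EuclideanSpace ℝ (Fin n))).Nonempty)
    (M β : ℝ) (hM : 1 ≤ M) (hβ₁ : 1 / 2 < β) (hβ₂ : β ≤ 1)
    (hgrowth : ∀ s ∈ Ico (0 : ℝ) T, ∀ t ∈ Ico (0 : ℝ) T,
      ∀ x ∉ E t, ∃ y ∉ E s, dist x y ≤ M * |t - s| ^ β)
    (lam p : ℝ) (hlam : 0 < lam)
    (x₀ : EuclideanSpace ℝ (Fin n)) (t₀ : ℝ) (ρ : ℝ) (hρ : 0 < ρ)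
    (hρsmall : ρ ≤ (min 1 (lam ^ ((p - 2) * β)) / (2 ^ (7 * β - 3) * M)) ^ (1 / (2 * β - 1)))
    (hlat : ∃ s ∈ Ioo (t₀ - lam ^ (2 - p) * (8 * ρ) ^ 2) (t₀ + lam ^ (2 - p) * (8 * ρ) ^ 2)
        ∩ Ioo (0 : ℝ) T, (ball x₀ (8 * ρ) \ E s).Nonempty) :
    ∀ t ∈ Ioo (t₀ - lam ^ (2 - p) * (8 * ρ) ^ 2) (t₀ + lam ^ (2 - p) * (8 * ρ) ^ 2)
        ∩ Ioo (0 : ℝ) T, (ball x₀ (16 * ρ) \ E t).Nonempty := by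
  intro t ht
  obtain ⟨s, ⟨⟨hs₁, hs₂⟩, hs₀, hsT⟩, x, hx, hxE⟩ := hlat
  obtain ⟨⟨ht₁, ht₂⟩, ht₀, htT⟩ := ht
  obtain ⟨y, hyE, hxy⟩ := hgrowth t ⟨ht₀.le, htT⟩ s ⟨hs₀.le, hsT⟩ x hxE
  have hβ : 0 < 2 * β - 1 := by linarith
  have hst : |s - t| ≤ 2 ^ (7 : ℝ) * lam ^ (2 - p) * ρ ^ (2 : ℝ) := by
    rw [Real.rpow_two, abs_le]
    norm_num
    constructor <;> linarith
  have hpow : |s - t| ^ β ≤ 2 ^ (7 * β) * lam ^ ((2 - p) * β) * ρ ^ (2 * β) := by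
    calc |s - t| ^ β ≤ (2 ^ (7 : ℝ) * lam ^ (2 - p) * ρ ^ (2 : ℝ)) ^ β :=
          Real.rpow_le_rpow (abs_nonneg _) hst (by linarith)
      _ = 2 ^ (7 * β) * lam ^ ((2 - p) * β) * ρ ^ (2 * β) := by
          rw [Real.mul_rpow (by positivity) (by positivity),
            Real.mul_rpow (by positivity) (by positivity), ← Real.rpow_mul (by norm_num),
            ← Real.rpow_mul hlam.le, ← Real.rpow_mul hρ.le]
  have hρpow : ρ ^ (2 * β - 1) * (2 ^ (7 * β - 3) * M) ≤ lam ^ ((p - 2) * β) := by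
    rw [← le_div_iff₀ (by positivity)]
    rw [one_div] at hρsmall
    refine ((Real.le_rpow_inv_iff_of_pos hρ.le (by positivity) hβ).1 hρsmall).trans ?_
    gcongr
    exact min_le_right _ _
  have hlam_mul : lam ^ ((2 - p) * β) * lam ^ ((p - 2) * β) = 1 := by
    rw [← Real.rpow_add hlam, show (2 - p) * β + (p - 2) * β = 0 by ring, Real.rpow_zero]
  have htwo : (2 : ℝ) ^ (7 * β) = 8 * 2 ^ (7 * β - 3) := by
    rw [Real.rpow_sub two_pos]
    norm_num
    ring
  have hρsplit : ρ ^ (2 * β) = ρ * ρ ^ (2 * β - 1) := by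
    rw [Real.rpow_sub hρ, Real.rpow_one]
    field_simp
  have hdist : dist x y ≤ 8 * ρ := by
    calc dist x y ≤ M * (2 ^ (7 * β) * lam ^ ((2 - p) * β) * ρ ^ (2 * β)) :=
          hxy.trans (by gcongr)
      _ = 8 * ρ * (lam ^ ((2 - p) * β) * (ρ ^ (2 * β - 1) * (2 ^ (7 * β - 3) * M))) := by
          rw [htwo, hρsplit]
          ring
      _ ≤ 8 * ρ * (lam ^ ((2 - p) * β) * lam ^ ((p - 2) * β)) := by gcongr
      _ = 8 * ρ := by rw [hlam_mul, mul_one]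
  refine ⟨y, ?_, hyE⟩
  rw [mem_ball] at hx ⊢
  linarith [dist_triangle_left y x₀ x]
end

section
/- Let n ≥ 1 be an integer, 2(n+1)/(n+2) < p < 2, β ∈ ( max{1/2, 2/(p(n+2)−2n)}, 1 ], and let d := p(2β−1)/(β(p(n+2)−2n)−2). Let 0 < R ≤ 1, 0 < R₁ < R₂ ≤ 2R, ĉ ≥ 1, λ_o ≥ 1, set B := ( 4ĉR/(R₂−R₁) )^{(n+2)d/p}, and let λ ≥ B·λ_o. Then for every real r with (R₂−R₁)·λ^{(p−2)β/(2β−1)}/ĉ < r, one has (4R/r)^{n+2} · λ^{p−2} · λ_o^{p/d} < λ^p. -/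
/-- Sub-intrinsic scaling estimate of Section 5, singular case `2(n+1)/(n+2) < p < 2`:
with the scaling deficit `d = p(2β-1)/(β(p(n+2)-2n) - 2)`, `B = (4ĉR/(R₂-R₁))^{(n+2)d/p}`
and `λ ≥ B λ₀`, for every radius `r > (R₂-R₁) λ^{(p-2)β/(2β-1)} / ĉ` one has
`(4R/r)^{n+2} λ^{p-2} λ₀^{p/d} < λ^p`. -/
theorem subintrinsic_estimate_singular (n : ℕ) (hn : 1 ≤ n) (p β : ℝ)
    (hp₁ : 2 * ((n : ℝ) + 1) / ((n : ℝ) + 2) < p) (hp₂ : p < 2)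
    (hβ₁ : max (1 / 2) (2 / (p * ((n : ℝ) + 2) - 2 * n)) < β) (hβ₂ : β ≤ 1)
    (R R₁ R₂ chat lam₀ lam : ℝ)
    (hR₀ : 0 < R) (hR₁ : R ≤ 1) (hR₁₀ : 0 < R₁) (hR₁₂ : R₁ < R₂) (hR₂ : R₂ ≤ 2 * R)
    (hchat : 1 ≤ chat) (hlam₀ : 1 ≤ lam₀)
    (hlam : (4 * chat * R / (R₂ - R₁)) ^
        (((n : ℝ) + 2) * (p * (2 * β - 1) / (β * (p * ((n : ℝ) + 2) - 2 * n) - 2)) / p)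
        * lam₀ ≤ lam) :
    ∀ r : ℝ, (R₂ - R₁) * lam ^ ((p - 2) * β / (2 * β - 1)) / chat < r →
      (4 * R / r) ^ ((n : ℝ) + 2) * lam ^ (p - 2) *
          lam₀ ^ (p / (p * (2 * β - 1) / (β * (p * ((n : ℝ) + 2) - 2 * n) - 2)))
        < lam ^ p := by
  intro r hr
  have hN : (0 : ℝ) < (n : ℝ) + 2 := by positivity
  have hp : 0 < p := lt_trans (by positivity) hp₁
  have hQ : 0 < p * ((n : ℝ) + 2) - 2 * n := by
    rw [div_lt_iff₀ hN] at hp₁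
    linarith
  obtain ⟨hβ_half, hβ_deg⟩ := max_lt_iff.mp hβ₁
  have hb : 0 < 2 * β - 1 := by linarith
  have hD : 0 < β * (p * ((n : ℝ) + 2) - 2 * n) - 2 := by
    rw [div_lt_iff₀ hQ] at hβ_deg
    linarith
  have hΔ : 0 < R₂ - R₁ := sub_pos.mpr hR₁₂
  have hc : 0 < chat := by linarith
  have hl₀ : 0 < lam₀ := by linarith
  set A : ℝ := 4 * chat * R / (R₂ - R₁) with hA_def
  have hA : 0 < A := by positivity
  set d : ℝ := p * (2 * β - 1) / (β * (p * ((n : ℝ) + 2) - 2 * n) - 2) with hd_def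
  have hd : 0 < d := by positivity
  have hl : 0 < lam := lt_of_lt_of_le (by positivity) hlam
  set s : ℝ := (p - 2) * β / (2 * β - 1) with hs_def
  have hr₀ : 0 < r := lt_trans (by positivity) hr
  have hratio : 4 * R / r < A * lam ^ (-s) := by
    have h : 4 * R / r < 4 * R / ((R₂ - R₁) * lam ^ s / chat) :=
      div_lt_div_of_pos_left (by positivity) (by positivity) hr
    refine h.trans_eq ?_
    rw [Real.rpow_neg hl.le, hA_def]
    field_simp
  have hpow : (4 * R / r) ^ ((n : ℝ) + 2) < A ^ ((n : ℝ) + 2) * lam ^ (-s * ((n : ℝ) + 2)) := by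
    rw [Real.rpow_mul hl.le, ← Real.mul_rpow hA.le (by positivity)]
    exact Real.rpow_lt_rpow (by positivity) hratio hN
  have hthreshold : A ^ ((n : ℝ) + 2) * lam₀ ^ (p / d) ≤ lam ^ (p / d) := by
    have h := Real.rpow_le_rpow (by positivity) hlam (by positivity : 0 ≤ p / d)
    rw [Real.mul_rpow (by positivity) hl₀.le, ← Real.rpow_mul hA.le] at h
    rwa [show ((n : ℝ) + 2) * d / p * (p / d) = (n : ℝ) + 2 by field_simp] at h
  have hexp : -s * ((n : ℝ) + 2) + (p - 2) + p / d = p := by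
    rw [hs_def, hd_def]
    field_simp
    ring
  calc (4 * R / r) ^ ((n : ℝ) + 2) * lam ^ (p - 2) * lam₀ ^ (p / d)
      < A ^ ((n : ℝ) + 2) * lam ^ (-s * ((n : ℝ) + 2)) * lam ^ (p - 2) * lam₀ ^ (p / d) := by
        gcongr
    _ = lam ^ (-s * ((n : ℝ) + 2)) * lam ^ (p - 2) *
          (A ^ ((n : ℝ) + 2) * lam₀ ^ (p / d)) := by ring
    _ ≤ lam ^ (-s * ((n : ℝ) + 2)) * lam ^ (p - 2) * lam ^ (p / d) := by gcongr
    _ = lam ^ p := by rw [← Real.rpow_add hl, ← Real.rpow_add hl, hexp]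
end

section
/- Let (X, μ) be a measure space with μ(X) ≤ 1, let h : X → [0,∞) be measurable, let 1 ≤ a ≤ b be real numbers, and let ε > 0, λ₁ > 0. Then ∫_{λ₁}^{∞} λ^{ε−1} ( ∫_{{h > λ}} h^a dμ )^{b/a} dλ ≤ (1/ε) ( ∫_{{h > λ₁}} h^{a+ε} dμ )^{(b+ε)/(a+ε)}. -/
open MeasureTheory Set

/-- On a measure space of total mass at most `1`, the integral of `f ^ a` is controlled by
the integral of the higher power `f ^ c`. -/
theorem lintegral_rpow_le_rpow_lintegral_rpow {X : Type*} [MeasurableSpace X] {μ : Measure X}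
    (hμ : μ univ ≤ 1) {f : X → ENNReal} (hf : AEMeasurable f μ) {a c : ℝ} (ha : 0 < a)
    (hac : a < c) : ∫⁻ x, f x ^ a ∂μ ≤ (∫⁻ x, f x ^ c ∂μ) ^ (a / c) := by
  have hc : 0 < c := ha.trans hac
  have hpq : (c / a).HolderConjugate (c / a).conjExponent :=
    Real.HolderConjugate.conjExponent ((one_lt_div ha).2 hac)
  have key := ENNReal.lintegral_mul_le_Lp_mul_Lq μ hpq (hf.pow_const a)
    (aemeasurable_const (b := (1 : ENNReal)))
  have hpow : ∀ x, (f x ^ a) ^ (c / a) = f x ^ c := fun x => by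
    rw [← ENNReal.rpow_mul, mul_div_cancel₀ c ha.ne']
  simp only [Pi.mul_apply, mul_one, ENNReal.one_rpow, lintegral_one, hpow, one_div_div] at key
  calc _ ≤ _ := key
    _ ≤ (∫⁻ x, f x ^ c ∂μ) ^ (a / c) * 1 := by
      gcongr
      exact ENNReal.rpow_le_one hμ (one_div_nonneg.2 hpq.symm.nonneg)
    _ = _ := mul_one _

/-- The integral of `l ^ (ε - 1)` over `(0, y)` equals `y ^ ε / ε`. -/
theorem lintegral_Ioo_rpow_sub_one {ε y : ℝ} (hε : 0 < ε) (hy : 0 ≤ y) :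
    ∫⁻ l in Ioo 0 y, ENNReal.ofReal (l ^ (ε - 1)) = ENNReal.ofReal (y ^ ε / ε) := by
  have hint : IntervalIntegrable (fun l : ℝ => l ^ (ε - 1)) volume 0 y :=
    intervalIntegral.intervalIntegrable_rpow' (by linarith)
  rw [setLIntegral_congr Ioo_ae_eq_Ioc, ← ofReal_integral_eq_lintegral_ofReal
      ((intervalIntegrable_iff_integrableOn_Ioc_of_le hy).1 hint),
    ← intervalIntegral.integral_of_le hy, integral_rpow (Or.inl (by linarith))]
  · simp [Real.zero_rpow hε.ne']
  · filter_upwards [ae_restrict_mem measurableSet_Ioc] with l hl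
    exact Real.rpow_nonneg hl.1.le _

/-- Truncated layer-cake estimate, by exchanging the order of integration. -/
theorem lintegral_rpow_mul_superlevel_le {X : Type*} [MeasurableSpace X] {μ : Measure X}
    [SFinite μ] {h : X → ℝ} (hh : Measurable h) {a ε lam : ℝ} (hε : 0 < ε) (hlam : 0 < lam) :
    ∫⁻ l in Ioi lam, ENNReal.ofReal (l ^ (ε - 1)) *
        ∫⁻ x in {x | l < h x}, ENNReal.ofReal (h x ^ a) ∂μ
      ≤ ENNReal.ofReal (1 / ε) *
        ∫⁻ x in {x | lam < h x}, ENNReal.ofReal (h x ^ (a + ε)) ∂μ := by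
  let F : ℝ → X → ENNReal := fun l x => {q : ℝ × X | q.1 < h q.2}.indicator
    (fun q => ENNReal.ofReal (q.1 ^ (ε - 1)) * ENNReal.ofReal (h q.2 ^ a)) (l, x)
  have hF : Measurable (Function.uncurry F) := by
    refine Measurable.indicator ?_ (measurableSet_lt measurable_fst (hh.comp measurable_snd))
    fun_prop
  have hmeas : ∀ l, MeasurableSet {x | l < h x} := fun l => measurableSet_lt measurable_const hh
  have hleft : ∀ l, ENNReal.ofReal (l ^ (ε - 1)) *
      ∫⁻ x in {x | l < h x}, ENNReal.ofReal (h x ^ a) ∂μ = ∫⁻ x, F l x ∂μ := fun l => by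
    rw [← lintegral_const_mul _ (by fun_prop), ← lintegral_indicator (hmeas l)]
    rfl
  simp_rw [hleft]
  rw [lintegral_lintegral_swap hF.aemeasurable, ← lintegral_const_mul _ (by fun_prop),
    ← lintegral_indicator (hmeas lam)]
  refine lintegral_mono fun x => ?_
  by_cases hx : lam < h x
  · have h0 : 0 < h x := hlam.trans hx
    rw [indicator_of_mem (show x ∈ {x | lam < h x} from hx)]
    calc ∫⁻ l in Ioi lam, F l x
        ≤ ∫⁻ l in Ioi 0, F l x := lintegral_mono_set (Ioi_subset_Ioi hlam.le)
      _ = ∫⁻ l in Ioo 0 (h x), ENNReal.ofReal (l ^ (ε - 1)) * ENNReal.ofReal (h x ^ a) := by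
        rw [← Ioi_inter_Iio, inter_comm, ← setLIntegral_indicator measurableSet_Iio]
        rfl
      _ = ENNReal.ofReal (1 / ε) * ENNReal.ofReal (h x ^ (a + ε)) := by
        rw [lintegral_mul_const _ (by fun_prop), lintegral_Ioo_rpow_sub_one hε h0.le,
          ← ENNReal.ofReal_mul (by positivity), ← ENNReal.ofReal_mul (by positivity),
          Real.rpow_add h0]
        congr 1
        ring
  · refine le_of_eq_of_le (setLIntegral_eq_zero measurableSet_Ioi fun l hl => ?_) zero_le
    have hlx : (l, x) ∉ {q : ℝ × X | q.1 < h q.2} := fun hlx => hx (lt_trans hl hlx)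
    exact indicator_of_notMem hlx _

/-- Layer-cake estimate with Hölder's inequality for the initial datum (proof of
Theorem 1.1): for a measure of total mass at most `1`, `1 ≤ a ≤ b`, `ε > 0`, `λ₁ > 0`,
`∫_{λ₁}^∞ λ^{ε-1} (∫_{{h > λ}} h^a dμ)^{b/a} dλ
  ≤ (1/ε) (∫_{{h > λ₁}} h^{a+ε} dμ)^{(b+ε)/(a+ε)}`. -/
theorem layer_cake_initial_datum {X : Type*} [MeasurableSpace X] (μ : Measure X)
    (hμ : μ univ ≤ 1)
    (h : X → ℝ) (hh : Measurable h) (hh0 : ∀ x, 0 ≤ h x)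
    (a b ε lam₁ : ℝ) (ha : 1 ≤ a) (hab : a ≤ b) (hε : 0 < ε) (hlam₁ : 0 < lam₁) :
    ∫⁻ l in Ioi lam₁, ENNReal.ofReal (l ^ (ε - 1)) *
        (∫⁻ x in {x | l < h x}, ENNReal.ofReal (h x ^ a) ∂μ) ^ (b / a)
      ≤ ENNReal.ofReal (1 / ε) *
        (∫⁻ x in {x | lam₁ < h x}, ENNReal.ofReal (h x ^ (a + ε)) ∂μ) ^
          ((b + ε) / (a + ε)) := by
  have : IsFiniteMeasure μ := ⟨hμ.trans_lt ENNReal.one_lt_top⟩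
  have ha0 : 0 < a := by linarith
  have hba : 0 ≤ b / a - 1 := sub_nonneg.2 ((one_le_div ha0).2 hab)
  set A : ℝ → ENNReal := fun l => ∫⁻ x in {x | l < h x}, ENNReal.ofReal (h x ^ a) ∂μ with hA
  set B : ENNReal := ∫⁻ x in {x | lam₁ < h x}, ENNReal.ofReal (h x ^ (a + ε)) ∂μ with hB
  have hAanti : Antitone A := fun l m hlm => lintegral_mono_set fun x hx => lt_of_le_of_lt hlm hx
  have hAB : A lam₁ ≤ B ^ (a / (a + ε)) := by
    have key := lintegral_rpow_le_rpow_lintegral_rpow (μ := μ.restrict {x | lam₁ < h x})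
      (f := fun x => ENNReal.ofReal (h x)) ((Measure.restrict_apply_le _ _).trans hμ)
      (by fun_prop) ha0 (lt_add_of_pos_right a hε)
    simpa only [hA, hB, ENNReal.ofReal_rpow_of_nonneg (hh0 _) ha0.le,
      ENNReal.ofReal_rpow_of_nonneg (hh0 _) (add_pos ha0 hε).le] using key
  have hsplit : ∀ l ∈ Ioi lam₁, ENNReal.ofReal (l ^ (ε - 1)) * A l ^ (b / a) ≤
      ENNReal.ofReal (l ^ (ε - 1)) * A l * A lam₁ ^ (b / a - 1) := fun l hl => by
    rw [show b / a = 1 + (b / a - 1) by ring, ENNReal.rpow_add_of_nonneg _ _ zero_le_one hba,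
      ENNReal.rpow_one, ← mul_assoc, add_sub_cancel_left]
    gcongr
    exact hAanti (le_of_lt hl)
  calc ∫⁻ l in Ioi lam₁, ENNReal.ofReal (l ^ (ε - 1)) * A l ^ (b / a)
      ≤ ∫⁻ l in Ioi lam₁, ENNReal.ofReal (l ^ (ε - 1)) * A l * A lam₁ ^ (b / a - 1) :=
        setLIntegral_mono' measurableSet_Ioi hsplit
    _ = (∫⁻ l in Ioi lam₁, ENNReal.ofReal (l ^ (ε - 1)) * A l) * A lam₁ ^ (b / a - 1) :=
        lintegral_mul_const _ (Measurable.mul (by fun_prop) hAanti.measurable)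
    _ ≤ ENNReal.ofReal (1 / ε) * B * (B ^ (a / (a + ε))) ^ (b / a - 1) := by
        gcongr
        exact lintegral_rpow_mul_superlevel_le hh hε hlam₁
    _ = ENNReal.ofReal (1 / ε) * B ^ ((b + ε) / (a + ε)) := by
        have hexp : (b + ε) / (a + ε) = 1 + a / (a + ε) * (b / a - 1) := by
          field_simp
          ring
        rw [hexp, ENNReal.rpow_add_of_nonneg _ _ zero_le_one (by positivity), ENNReal.rpow_one,
          ENNReal.rpow_mul, mul_assoc]
end
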